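/- Let K ⊆ ℝⁿ be a convex set and let f_1,…,f_m : ℝⁿ → ℝ be convex functions. If x* ∈ K is a weakly Pareto point of the multiobjective problem min_{x∈K} (f_1(x),…,f_m(x)), then there exists a nonzero vector w* ∈ ℝ^m with all components nonnegative such that ⟨w*, F(x*)⟩ ≤ ⟨w*, F(x)⟩ for all x ∈ K, where F(x) = (f_1(x),…,f_m(x)). -/

import Mathlib

/-- The points strictly dominated by a value of a convex vector function form a convex set. -/
theorem convex_setOf_exists_forall_lt {E ι : Type*} [AddCommGroup E] [Module ℝ E]
    {K : Set E} {f : ι → E → ℝ} (hK : Convex ℝ K) (hf : ∀ i, ConvexOn ℝ K (f i)) :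
    Convex ℝ {y : ι → ℝ | ∃ x ∈ K, ∀ i, f i x < y i} := by
  rintro y ⟨x, hx, hxy⟩ z ⟨x', hx', hxz⟩ a b ha hb hab
  refine ⟨a • x + b • x', hK hx hx' ha hb hab, fun i => ?_⟩
  refine ((hf i).2 hx hx' ha hb hab).trans_lt ?_
  simp only [Pi.add_apply, Pi.smul_apply, smul_eq_mul]
  rcases ha.eq_or_lt with rfl | ha
  · obtain rfl : b = 1 := by linarith
    simpa using hxz i
  · exact add_lt_add_of_lt_of_le (mul_lt_mul_of_pos_left (hxy i) ha)
      (mul_le_mul_of_nonneg_left (hxz i).le hb)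

/-- The points strictly dominated by a value of a vector function form an open set. -/
theorem isOpen_setOf_exists_forall_lt {E ι : Type*} [Finite ι] (K : Set E) (f : ι → E → ℝ) :
    IsOpen {y : ι → ℝ | ∃ x ∈ K, ∀ i, f i x < y i} := by
  have h : {y : ι → ℝ | ∃ x ∈ K, ∀ i, f i x < y i} =
      ⋃ x ∈ K, Set.univ.pi fun i => Set.Ioi (f i x) := by
    ext y
    simp
  rw [h]
  exact isOpen_biUnion fun x _ => isOpen_set_pi Set.finite_univ fun i _ => isOpen_Ioi

/-- For a convex multiobjective problem, every weakly Pareto point admits a nonzero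
nonnegative vector `w` with `⟨w, F(xs)⟩ ≤ ⟨w, F(x)⟩` for all `x ∈ K`. -/
theorem weakly_pareto_separation {n m : ℕ}
    (K : Set (Fin n → ℝ)) (hK : Convex ℝ K)
    (f : Fin m → (Fin n → ℝ) → ℝ)
    (hf : ∀ i, ConvexOn ℝ Set.univ (f i))
    (xs : Fin n → ℝ) (hxs : xs ∈ K)
    (hwp : ¬ ∃ x ∈ K, ∀ i, f i x < f i xs) :
    ∃ w : Fin m → ℝ, w ≠ 0 ∧ (∀ i, 0 ≤ w i) ∧
      ∀ x ∈ K, (∑ i, w i * f i xs) ≤ ∑ i, w i * f i x := by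
  obtain ⟨g, hg⟩ := geometric_hahn_banach_point_open
    (convex_setOf_exists_forall_lt hK fun i => (hf i).subset (Set.subset_univ K) hK)
    (isOpen_setOf_exists_forall_lt K f) (x := fun i => f i xs) hwp
  have hrep : ∀ y : Fin m → ℝ, ∑ i, g (Pi.single i 1) * y i = g y := fun y => by
    conv_rhs => rw [pi_eq_sum_univ' y]
    simp [mul_comm]
  have key : ∀ x ∈ K, ∀ v : Fin m → ℝ, (∀ i, 0 < v i) →
      g (fun i => f i xs) < g (fun i => f i x) + g v := fun x hx v hv => by
    rw [← map_add]
    exact hg _ ⟨x, hx, fun i => by simpa using hv i⟩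
  have hpos : ∀ v : Fin m → ℝ, (∀ i, 0 < v i) → 0 < g v := fun v hv => by
    linarith [key xs hxs v hv]
  have hone : 0 < g 1 := hpos 1 fun i => by simp
  refine ⟨fun i => g (Pi.single i 1), fun hw => ?_, fun i => ?_, fun x hx => ?_⟩
  · have h := hrep 1
    simp only [funext_iff, Pi.zero_apply] at hw
    simp only [hw, zero_mul, Finset.sum_const_zero] at h
    exact hone.ne h
  · by_contra! hneg
    have ht : 0 ≤ g 1 / -g (Pi.single i 1) := div_nonneg hone.le (by linarith)
    have h := hpos (1 + (g 1 / -g (Pi.single i 1)) • Pi.single i 1) fun j => by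
      have : (0 : ℝ) ≤ (Pi.single i 1 : Fin m → ℝ) j :=
        (Pi.single_nonneg.2 zero_le_one : (0 : Fin m → ℝ) ≤ Pi.single i 1) j
      have := mul_nonneg ht this
      simp only [Pi.add_apply, Pi.one_apply, Pi.smul_apply, smul_eq_mul]
      linarith
    rw [map_add, map_smul, smul_eq_mul, div_neg, neg_mul, div_mul_cancel₀ _ hneg.ne] at h
    linarith
  · rw [hrep, hrep]
    by_contra! hlt
    have h := key x hx (((g (fun i => f i xs) - g fun i => f i x) / g 1) • 1) fun i => by
      simpa using div_pos (sub_pos.2 hlt) hone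
    rw [map_smul, smul_eq_mul, div_mul_cancel₀ _ hone.ne'] at h
    linarith
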